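/- For the lens space M = L(p,q) and every spin^c structure [k], one has T_{M,[k]}(1) - λ(M)/p = d(M,[k])/2, where d(M,[k]) = (K²+s)/4 - 2χ(l'_{[k]}), T is the sign-refined Reidemeister–Turaev torsion and λ the Casson–Walker invariant. Concretely: (1/p)·Σ_{ξ^p=1, ξ≠1} ξ^{-a}/((ξ-1)(ξ^q-1)) - s(q,p)/2 = (1/2)·[(p-1)/(2p) - 3 s(q,p) - 2χ(l'_{[-a g_s]})] for every 0 ≤ a < p. -/

import Mathlib

/-- The sawtooth function `((x)) = {x} - 1/2` for `x ∉ ℤ`, and `((x)) = 0` for `x ∈ ℤ`. -/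
noncomputable def saw (x : ℚ) : ℚ := if Int.fract x = 0 then 0 else Int.fract x - 1 / 2

/-- The Dedekind sum `s(q,p) = ∑_{l=0}^{p-1} ((l/p)) ((q l/p))`. -/
noncomputable def dedekindSum (q : ℤ) (p : ℕ) : ℚ :=
  ∑ l ∈ Finset.range p, saw ((l : ℚ) / p) * saw ((q : ℚ) * l / p)

/-- The set of nontrivial `p`-th roots of unity in `ℂ`. -/
noncomputable def nontrivialRoots (p : ℕ) : Finset ℂ :=
  (Polynomial.nthRoots p (1 : ℂ)).toFinset.erase 1

theorem mem_nontrivialRoots {p : ℕ} (hp : 0 < p) {ξ : ℂ} :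
    ξ ∈ nontrivialRoots p ↔ ξ ^ p = 1 ∧ ξ ≠ 1 := by
  simp [nontrivialRoots, Polynomial.mem_nthRoots hp, and_comm]

theorem zpow_eq_one_of_pow_eq_one {p : ℕ} {ξ : ℂ} (h : ξ ^ p = 1) {m : ℤ}
    (hm : (p : ℤ) ∣ m) : ξ ^ m = 1 := by
  obtain ⟨k, rfl⟩ := hm
  rw [zpow_mul, zpow_natCast, h, one_zpow]

theorem zpow_eq_zpow_of_pow_eq_one {p : ℕ} (hp : 0 < p) {ξ : ℂ} (h : ξ ^ p = 1) {m n : ℤ}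
    (hmn : m ≡ n [ZMOD p]) : ξ ^ m = ξ ^ n := by
  have h0 : ξ ≠ 0 := by
    rintro rfl
    simp [hp.ne'] at h
  have := zpow_eq_one_of_pow_eq_one h hmn.dvd
  rw [zpow_sub₀ h0, div_eq_one_iff_eq (zpow_ne_zero _ h0)] at this
  exact this.symm

theorem zpow_mem_nontrivialRoots {p : ℕ} (hp : 0 < p) {ξ : ℂ} (h : ξ ∈ nontrivialRoots p)
    {m n : ℤ} (hmn : m * n ≡ 1 [ZMOD p]) : ξ ^ m ∈ nontrivialRoots p := by
  rw [mem_nontrivialRoots hp] at h ⊢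
  refine ⟨?_, fun h1 => h.2 ?_⟩
  · rw [← zpow_natCast, ← zpow_mul]
    exact zpow_eq_one_of_pow_eq_one h.1 (dvd_mul_left _ _)
  · rw [← zpow_one ξ, ← zpow_eq_zpow_of_pow_eq_one hp h.1 hmn, zpow_mul, h1, one_zpow]

theorem sum_nontrivialRoots_comp_zpow {p : ℕ} (hp : 0 < p) {m n : ℤ}
    (hmn : m * n ≡ 1 [ZMOD p]) (f : ℂ → ℂ) :
    ∑ ξ ∈ nontrivialRoots p, f (ξ ^ m) = ∑ ξ ∈ nontrivialRoots p, f ξ := by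
  have hnm : n * m ≡ 1 [ZMOD p] := by rwa [mul_comm]
  refine Finset.sum_nbij' (fun ξ => ξ ^ m) (fun ξ => ξ ^ n)
    (fun ξ h => zpow_mem_nontrivialRoots hp h hmn)
    (fun ξ h => zpow_mem_nontrivialRoots hp h hnm) (fun ξ h => ?_) (fun ξ h => ?_)
    (fun ξ _ => rfl)
  · simpa [← zpow_mul] using
      zpow_eq_zpow_of_pow_eq_one hp ((mem_nontrivialRoots hp).1 h).1 hmn
  · simpa [← zpow_mul] using
      zpow_eq_zpow_of_pow_eq_one hp ((mem_nontrivialRoots hp).1 h).1 hnm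

theorem card_nontrivialRoots {p : ℕ} (hp : 0 < p) :
    ((nontrivialRoots p).card : ℂ) = p - 1 := by
  have hprim := Complex.isPrimitiveRoot_exp p hp.ne'
  have h1 : (1 : ℂ) ∈ (Polynomial.nthRoots p (1 : ℂ)).toFinset := by
    simp [Polynomial.mem_nthRoots hp]
  have hc : (Polynomial.nthRoots p (1 : ℂ)).toFinset.card = p := by
    rw [Multiset.toFinset_card_of_nodup hprim.nthRoots_one_nodup, hprim.card_nthRoots_one]
  rw [nontrivialRoots, Finset.card_erase_of_mem h1, hc, Nat.cast_pred hp]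

theorem sum_nontrivialRoots_zpow {p : ℕ} (hp : 0 < p) {m : ℤ} (hm : ¬ (p : ℤ) ∣ m) :
    ∑ ξ ∈ nontrivialRoots p, ξ ^ m = -1 := by
  have hprim := Complex.isPrimitiveRoot_exp p hp.ne'
  set ζ := Complex.exp (2 * Real.pi * Complex.I / p)
  have hζ0 : ζ ≠ 0 := Complex.exp_ne_zero _
  set R := (Polynomial.nthRoots p (1 : ℂ)).toFinset
  have hR : ∀ ξ, ξ ∈ R ↔ ξ ^ p = 1 := fun ξ => by simp [R, Polynomial.mem_nthRoots hp]
  have hinv : ∑ ξ ∈ R, (ζ * ξ) ^ m = ∑ ξ ∈ R, ξ ^ m :=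
    Finset.sum_nbij' (fun ξ => ζ * ξ) (fun ξ => ζ⁻¹ * ξ)
      (fun ξ h => by rw [hR] at h ⊢; rw [mul_pow, h, hprim.pow_eq_one, one_mul])
      (fun ξ h => by
        rw [hR] at h ⊢; rw [mul_pow, h, inv_pow, hprim.pow_eq_one, inv_one, one_mul])
      (fun ξ _ => inv_mul_cancel_left₀ hζ0 ξ) (fun ξ _ => mul_inv_cancel_left₀ hζ0 ξ)
      (fun ξ _ => rfl)
  have hne : ζ ^ m ≠ 1 := fun h => hm ((hprim.zpow_eq_one_iff_dvd m).1 h)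
  simp_rw [mul_zpow, ← Finset.mul_sum] at hinv
  have hzero : ∑ ξ ∈ R, ξ ^ m = 0 := by
    by_contra h0
    exact hne ((mul_eq_right₀ h0).1 hinv)
  have h1 : (1 : ℂ) ∈ R := by simp [hR]
  rw [← Finset.add_sum_erase _ _ h1, one_zpow] at hzero
  exact eq_neg_of_add_eq_zero_right hzero

theorem sum_nontrivialRoots_inv_sub_one {p : ℕ} (hp : 0 < p) :
    ∑ ξ ∈ nontrivialRoots p, 1 / (ξ - 1) = -((p : ℂ) - 1) / 2 := by
  have hinv := sum_nontrivialRoots_comp_zpow hp (m := -1) (n := -1) (by simp [Int.ModEq])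
    (fun ξ => 1 / (ξ - 1))
  have hterm : ∀ ξ ∈ nontrivialRoots p, 1 / (ξ ^ (-1 : ℤ) - 1) = -1 - 1 / (ξ - 1) := by
    intro ξ h
    obtain ⟨h, h1⟩ := (mem_nontrivialRoots hp).1 h
    have h0 : ξ ≠ 0 := by
      rintro rfl
      simp [hp.ne'] at h
    have h2 : ξ - 1 ≠ 0 := sub_ne_zero.2 h1
    have h3 : 1 - ξ ≠ 0 := sub_ne_zero.2 h1.symm
    rw [zpow_neg_one]
    field_simp
    ring
  rw [Finset.sum_congr rfl hterm, Finset.sum_sub_distrib, Finset.sum_const, nsmul_eq_mul,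
    card_nontrivialRoots hp] at hinv
  linear_combination -hinv / 2

theorem sum_nontrivialRoots_zpow_neg_natCast_div {p : ℕ} (hp : 0 < p) {m : ℕ} (hm : m < p) :
    ∑ ξ ∈ nontrivialRoots p, ξ ^ (-(m : ℤ)) / (ξ - 1) = m - ((p : ℂ) - 1) / 2 := by
  induction m with
  | zero =>
    simpa only [Nat.cast_zero, neg_zero, zpow_zero, zero_sub, neg_div] using
      sum_nontrivialRoots_inv_sub_one hp
  | succ m ih =>
    have hdvd : ¬ (p : ℤ) ∣ -((m + 1 : ℕ) : ℤ) := by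
      rw [dvd_neg, Int.natCast_dvd_natCast]
      exact Nat.not_dvd_of_pos_of_lt m.succ_pos hm
    have hsum := sum_nontrivialRoots_zpow hp hdvd
    have hterm : ∀ ξ ∈ nontrivialRoots p, ξ ^ (-((m + 1 : ℕ) : ℤ)) / (ξ - 1)
        = ξ ^ (-(m : ℤ)) / (ξ - 1) - ξ ^ (-((m + 1 : ℕ) : ℤ)) := by
      intro ξ h
      obtain ⟨h, h1⟩ := (mem_nontrivialRoots hp).1 h
      have h0 : ξ ≠ 0 := by
        rintro rfl
        simp [hp.ne'] at h
      have h2 : ξ - 1 ≠ 0 := sub_ne_zero.2 h1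
      have h4 : ξ ^ (-(m : ℤ)) = ξ ^ (-((m + 1 : ℕ) : ℤ)) * ξ := by
        rw [← zpow_add_one₀ h0]
        congr 1
        push_cast
        ring
      rw [h4]
      field_simp
      ring
    rw [Finset.sum_congr rfl hterm, Finset.sum_sub_distrib, ih (by omega), hsum]
    push_cast
    ring

theorem sum_nontrivialRoots_zpow_neg_div {p : ℕ} (hp : 0 < p) (m : ℤ) :
    ∑ ξ ∈ nontrivialRoots p, ξ ^ (-m) / (ξ - 1)
      = p * ((Int.fract ((m : ℚ) / p) : ℚ) : ℂ) - ((p : ℂ) - 1) / 2 := by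
  have hp' : (0 : ℤ) < p := by exact_mod_cast hp
  obtain ⟨r, hr⟩ := Int.eq_ofNat_of_zero_le (Int.emod_nonneg m hp'.ne')
  have hrp : r < p := by exact_mod_cast hr ▸ Int.emod_lt_of_pos m hp'
  have hpC : (p : ℂ) ≠ 0 := by exact_mod_cast hp.ne'
  have hfract : Int.fract ((m : ℚ) / p) = (r : ℚ) / p := by
    rw [Int.fract_div_intCast_eq_div_intCast_mod, hr]
    rfl
  have hmod : -m ≡ -(r : ℤ) [ZMOD p] := by
    rw [← hr]
    exact (Int.mod_modEq m p).symm.neg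
  rw [Finset.sum_congr rfl fun ξ h => by
    rw [zpow_eq_zpow_of_pow_eq_one hp ((mem_nontrivialRoots hp).1 h).1 hmod],
    sum_nontrivialRoots_zpow_neg_natCast_div hp hrp, hfract]
  push_cast
  field_simp

theorem sub_one_mul_sum_range_natCast_mul_pow (x : ℂ) (n : ℕ) :
    (x - 1) * ∑ l ∈ Finset.range n, (l : ℂ) * x ^ l
      = n * x ^ n - x * ∑ l ∈ Finset.range n, x ^ l := by
  induction n with
  | zero => simp
  | succ n ih =>
    rw [Finset.sum_range_succ, Finset.sum_range_succ, mul_add, ih]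
    push_cast
    ring

theorem inv_sub_one_eq_sum_range {p : ℕ} (hp : 0 < p) {x : ℂ} (h : x ^ p = 1) (h1 : x ≠ 1) :
    1 / (x - 1) = ∑ l ∈ Finset.range p, (l : ℂ) / p * x ^ l := by
  have hpC : (p : ℂ) ≠ 0 := by exact_mod_cast hp.ne'
  have h2 : x - 1 ≠ 0 := sub_ne_zero.2 h1
  have hsum := sub_one_mul_sum_range_natCast_mul_pow x p
  rw [geom_sum_eq h1, h] at hsum
  simp_rw [div_mul_eq_mul_div, ← Finset.sum_div]
  field_simp
  linear_combination -hsum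

theorem saw_neg (x : ℚ) : saw (-x) = -saw x := by
  unfold saw
  by_cases h : Int.fract x = 0
  · rw [if_pos h, if_pos (Int.fract_neg_eq_zero.2 h), neg_zero]
  · rw [if_neg h, if_neg (Int.fract_neg_eq_zero.not.2 h), Int.fract_neg h]
    ring

theorem saw_add_intCast (x : ℚ) (n : ℤ) : saw (x + n) = saw x := by
  simp [saw]

theorem sum_range_saw_mul_div (p : ℕ) (q : ℤ) :
    ∑ l ∈ Finset.range p, saw ((q : ℚ) * l / p) = 0 := by
  rcases p with _ | p
  · simp
  rw [Finset.sum_range_succ']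
  have hrefl : ∑ l ∈ Finset.range p, saw ((q : ℚ) * (l + 1 : ℕ) / (p + 1 : ℕ))
      = ∑ l ∈ Finset.range p, -saw ((q : ℚ) * (l + 1 : ℕ) / (p + 1 : ℕ)) := by
    rw [← Finset.sum_range_reflect]
    refine Finset.sum_congr rfl fun l hl => ?_
    have hl := Finset.mem_range.1 hl
    have hcast : ((p - 1 - l + 1 : ℕ) : ℚ) = p - l := by
      rw [show p - 1 - l + 1 = p - l by omega, Nat.cast_sub hl.le]
    rw [hcast, ← saw_neg, ← saw_add_intCast (-((q : ℚ) * (l + 1 : ℕ) / (p + 1 : ℕ))) q]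
    congr 1
    have : (p : ℚ) + 1 ≠ 0 := by positivity
    push_cast
    field_simp
    ring
  rw [Finset.sum_neg_distrib] at hrefl
  have h0 : saw 0 = 0 := by simp [saw]
  simp only [Nat.cast_zero, mul_zero, zero_div, h0, add_zero]
  linarith

theorem saw_natCast_div {p l : ℕ} (hl : l < p) (hl0 : l ≠ 0) :
    saw ((l : ℚ) / p) = (l : ℚ) / p - 1 / 2 := by
  have hp : (0 : ℚ) < p := by exact_mod_cast (Nat.zero_le l).trans_lt hl
  have hl' : (0 : ℚ) < l := by exact_mod_cast Nat.pos_of_ne_zero hl0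
  have h : Int.fract ((l : ℚ) / p) = l / p :=
    Int.fract_eq_self.2 ⟨by positivity, (div_lt_one hp).2 (by exact_mod_cast hl)⟩
  rw [saw, h, if_neg (by positivity)]

theorem dedekindSum_eq_sum_div_mul_saw (q : ℤ) (p : ℕ) :
    dedekindSum q p = ∑ l ∈ Finset.range p, (l : ℚ) / p * saw ((q : ℚ) * l / p) := by
  have h : dedekindSum q p
      = ∑ l ∈ Finset.range p, ((l : ℚ) / p - 1 / 2) * saw ((q : ℚ) * l / p) := by
    refine Finset.sum_congr rfl fun l hl => ?_
    rcases eq_or_ne l 0 with rfl | hl0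
    · simp [saw]
    · rw [saw_natCast_div (Finset.mem_range.1 hl) hl0]
  rw [h]
  simp_rw [sub_mul]
  rw [Finset.sum_sub_distrib, ← Finset.mul_sum, sum_range_saw_mul_div, mul_zero, sub_zero]

theorem sum_div_mul_fract_neg {p : ℕ} (hp : 0 < p) {q : ℤ} (hq : IsCoprime q (p : ℤ)) :
    ∑ l ∈ Finset.range p,
        (l : ℚ) / p * (Int.fract (((-(q * l) : ℤ) : ℚ) / p) - 1 / 2 + 1 / (2 * p))
      = ((p : ℚ) - 1) / (4 * p) - dedekindSum q p := by
  have hpQ : (p : ℚ) ≠ 0 := by exact_mod_cast hp.ne'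
  have hterm : ∀ l ∈ Finset.range p,
      (l : ℚ) / p * (Int.fract (((-(q * l) : ℤ) : ℚ) / p) - 1 / 2 + 1 / (2 * p))
        = (l : ℚ) * (1 / (2 * p ^ 2)) - (l : ℚ) / p * saw ((q : ℚ) * l / p) := by
    intro l hl
    rcases eq_or_ne l 0 with rfl | hl0
    · simp
    have hne : Int.fract (((-(q * l) : ℤ) : ℚ) / p) ≠ 0 := by
      rw [← Int.cast_natCast (R := ℚ) p, Ne, Int.fract_eq_zero_iff]
      rintro ⟨k, hk⟩
      rw [eq_div_iff (by exact_mod_cast hp.ne')] at hk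
      have hk' : k * p = -(q * l) := by exact_mod_cast hk
      have hdvd : (p : ℤ) ∣ l :=
        hq.symm.dvd_of_dvd_mul_left (dvd_neg.1 ⟨k, by rw [← hk', mul_comm]⟩)
      exact Nat.not_dvd_of_pos_of_lt (Nat.pos_of_ne_zero hl0) (Finset.mem_range.1 hl)
        (Int.natCast_dvd_natCast.1 hdvd)
    have hsaw : Int.fract (((-(q * l) : ℤ) : ℚ) / p) - 1 / 2 = -saw ((q : ℚ) * l / p) := by
      rw [← saw_neg, show -((q : ℚ) * l / p) = ((-(q * l) : ℤ) : ℚ) / p by push_cast; ring,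
        saw, if_neg hne]
    rw [hsaw]
    field_simp
    ring
  have hgauss : ∑ l ∈ Finset.range p, (l : ℚ) = p * (p - 1) / 2 := by
    have h := Finset.sum_range_id_mul_two p
    have h' : ((∑ l ∈ Finset.range p, l : ℕ) : ℚ) * 2 = p * (p - 1) := by
      rw [← Nat.cast_pred hp]
      exact_mod_cast h
    push_cast at h'
    linarith
  rw [Finset.sum_congr rfl hterm, Finset.sum_sub_distrib, ← dedekindSum_eq_sum_div_mul_saw,
    ← Finset.sum_mul, hgauss]
  field_simp
  ring

theorem sum_nontrivialRoots_inv_mul_inv {p : ℕ} (hp : 0 < p) {q q' : ℤ}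
    (hq : IsCoprime q (p : ℤ)) (hq' : q * q' ≡ 1 [ZMOD p]) :
    1 / (p : ℂ) * ∑ ξ ∈ nontrivialRoots p, 1 / ((ξ - 1) * (ξ ^ q - 1))
      = ((p : ℂ) - 1) / (4 * p) - (dedekindSum q p : ℂ) := by
  have hpC : (p : ℂ) ≠ 0 := by exact_mod_cast hp.ne'
  have hterm : ∀ ξ ∈ nontrivialRoots p, 1 / ((ξ - 1) * (ξ ^ q - 1))
      = ∑ l ∈ Finset.range p, (l : ℂ) / p * (ξ ^ (-(-(q * l) : ℤ)) / (ξ - 1)) := by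
    intro ξ h
    obtain ⟨h, h1⟩ := (mem_nontrivialRoots hp).1 (zpow_mem_nontrivialRoots hp h hq')
    rw [mul_comm, ← div_div, inv_sub_one_eq_sum_range hp h h1,
      Finset.sum_div]
    refine Finset.sum_congr rfl fun l _ => ?_
    rw [neg_neg, zpow_mul, zpow_natCast, mul_div_assoc]
  have hbase := congrArg (fun x : ℚ => (x : ℂ)) (sum_div_mul_fract_neg hp hq)
  simp only [Rat.cast_sum, Rat.cast_mul, Rat.cast_div, Rat.cast_add, Rat.cast_sub, Rat.cast_natCast,
    Rat.cast_one, Rat.cast_ofNat] at hbase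
  rw [Finset.sum_congr rfl hterm, Finset.sum_comm, ← hbase, Finset.mul_sum]
  refine Finset.sum_congr rfl fun l _ => ?_
  rw [← Finset.mul_sum, sum_nontrivialRoots_zpow_neg_div hp]
  field_simp
  ring

theorem sum_nontrivialRoots_zpow_neg_div_mul {p : ℕ} (hp : 0 < p) {q q' : ℤ}
    (hq' : q * q' ≡ 1 [ZMOD p]) (n : ℕ) :
    1 / (p : ℂ) * ∑ ξ ∈ nontrivialRoots p, ξ ^ (-(n : ℤ)) / ((ξ - 1) * (ξ ^ q - 1))
      = 1 / (p : ℂ) * ∑ ξ ∈ nontrivialRoots p, 1 / ((ξ - 1) * (ξ ^ q - 1))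
        - ((n : ℂ) * (1 - (p : ℂ)) / (2 * p)
          + ∑ j ∈ Finset.Icc (1 : ℤ) n,
              ((Int.fract (((j * q' : ℤ) : ℚ) / (p : ℚ)) : ℚ) : ℂ)) := by
  have hpC : (p : ℂ) ≠ 0 := by exact_mod_cast hp.ne'
  induction n with
  | zero => simp
  | succ n ih =>
    have hIcc : Finset.Icc (1 : ℤ) ((n + 1 : ℕ) : ℤ)
        = insert ((n + 1 : ℕ) : ℤ) (Finset.Icc (1 : ℤ) n) := by
      ext j
      simp only [Finset.mem_Icc, Finset.mem_insert]
      omega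
    have hterm : ∀ ξ ∈ nontrivialRoots p,
        ξ ^ (-((n + 1 : ℕ) : ℤ)) / ((ξ - 1) * (ξ ^ q - 1))
          = ξ ^ (-(n : ℤ)) / ((ξ - 1) * (ξ ^ q - 1))
            - (ξ ^ q) ^ (-(((n + 1 : ℕ) : ℤ) * q')) / (ξ ^ q - 1) := by
      intro ξ hξ
      have hξq := ((mem_nontrivialRoots hp).1 (zpow_mem_nontrivialRoots hp hξ hq')).2
      obtain ⟨h, h1⟩ := (mem_nontrivialRoots hp).1 hξ
      have h0 : ξ ≠ 0 := by
        rintro rfl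
        simp [hp.ne'] at h
      have h2 : ξ - 1 ≠ 0 := sub_ne_zero.2 h1
      have h3 : ξ ^ q - 1 ≠ 0 := sub_ne_zero.2 hξq
      have h4 : ξ ^ (-(n : ℤ)) = ξ ^ (-((n + 1 : ℕ) : ℤ)) * ξ := by
        rw [← zpow_add_one₀ h0]
        congr 1
        push_cast
        ring
      have h5 : (ξ ^ q) ^ (-(((n + 1 : ℕ) : ℤ) * q')) = ξ ^ (-((n + 1 : ℕ) : ℤ)) := by
        rw [← zpow_mul]
        refine zpow_eq_zpow_of_pow_eq_one hp h ?_
        have := hq'.mul_left (-((n + 1 : ℕ) : ℤ))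
        rw [mul_one] at this
        convert this using 1
        ring
      rw [h4, h5]
      generalize ξ ^ (-((n + 1 : ℕ) : ℤ)) = y
      generalize ξ ^ q - 1 = z at h3
      field_simp
      ring
    rw [Finset.sum_congr rfl hterm, Finset.sum_sub_distrib, mul_sub, ih,
      sum_nontrivialRoots_comp_zpow hp hq'
        (fun η => η ^ (-(((n + 1 : ℕ) : ℤ) * q')) / (η - 1)),
      sum_nontrivialRoots_zpow_neg_div hp, hIcc, Finset.sum_insert (by simp)]
    generalize Int.fract (((((n + 1 : ℕ) : ℤ) * q' : ℤ) : ℚ) / (p : ℚ)) = f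
    generalize ∑ j ∈ Finset.Icc (1 : ℤ) n,
      ((Int.fract (((j * q' : ℤ) : ℚ) / (p : ℚ)) : ℚ) : ℂ) = g
    push_cast
    field_simp
    ring

/-- for the lens space `M = L(p,q)` and the spin^c structure indexed by
`0 ≤ a < p`, one has `T_{M,[k]}(1) - λ(M)/p = d(M,[k])/2`; concretely,
`(1/p) ∑_{ξ^p=1, ξ≠1} ξ^{-a}/((ξ-1)(ξ^q-1)) - s(q,p)/2
  = (1/2)[(p-1)/(2p) - 3 s(q,p) - 2 χ(l'_{[-a g_s]})]`
where `χ(l'_{[-a g_s]}) = a(1-p)/(2p) + ∑_{j=1}^{a} {j q'/p}`. -/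
theorem lens_torsion_casson_walker (p : ℕ) (hp : 0 < p) (q q' a : ℤ)
    (hq : IsCoprime q (p : ℤ))
    (hq' : q * q' ≡ 1 [ZMOD (p : ℤ)])
    (hq'0 : 0 < q') (hq'p : q' < p)
    (ha0 : 0 ≤ a) (hap : a < (p : ℤ)) :
    (1 / (p : ℂ)) * (∑ ξ ∈ nontrivialRoots p, ξ ^ (-a) / ((ξ - 1) * (ξ ^ q - 1)))
        - (dedekindSum q p : ℂ) / 2
      = (1 / 2) * (((p : ℂ) - 1) / (2 * p) - 3 * (dedekindSum q p : ℂ)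
        - 2 * (((a : ℂ) * (1 - (p : ℂ))) / (2 * p)
          + ∑ j ∈ Finset.Icc (1 : ℤ) a,
              ((Int.fract (((j * q' : ℤ) : ℚ) / (p : ℚ)) : ℚ) : ℂ))) := by
  lift a to ℕ using ha0
  have hpC : (p : ℂ) ≠ 0 := by exact_mod_cast hp.ne'
  rw [sum_nontrivialRoots_zpow_neg_div_mul hp hq', sum_nontrivialRoots_inv_mul_inv hp hq hq',
    Int.cast_natCast]
  field_simp
  ring
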